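/- Let r, u ∈ (0,∞). If for all x, y ∈ ℓ_{r,u}(ℕ) the double family x ⊗ y = (x_n y_m) belongs to ℓ_{r,u}(ℕ×ℕ), then u ≤ r. -/

import Mathlib

noncomputable section
noncomputable section

/-- The `n`-th approximation number of a family `x : I → ℂ`
(`a_n(x) = inf { c ≥ 0 : card { i : |x_i| ≥ c } < n }`), i.e. the `n`-th term of the
nonincreasing rearrangement of `x` (indexed from `n = 1`). -/
def seqApproxNum {I : Type*} (x : I → ℂ) (n : ℕ) : ℝ :=
  sInf { c : ℝ | 0 ≤ c ∧ { i : I | c ≤ ‖x i‖ }.Finite ∧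
    Nat.card { i : I | c ≤ ‖x i‖ } < n }

/-- Membership in the Lorentz sequence space `ℓ_{p,q}(I)`: the family is bounded and its
nonincreasing rearrangement `(a_n(x))_{n≥1}` satisfies `Σ_n n^{q/p−1} a_n(x)^q < ∞`. -/
def MemLorentzSeq {I : Type*} (p q : ℝ) (x : I → ℂ) : Prop :=
  BddAbove (Set.range fun i => ‖x i‖) ∧
  Summable fun n : ℕ => ((n : ℝ) + 1) ^ (q / p - 1) * seqApproxNum x (n + 1) ^ q

end

noncomputable section

open Finset in
/-- If at least `n` entries of a bounded family have modulus at least `v`, then `v ≤ a_n(x)`. -/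
theorem le_seqApproxNum {I : Type*} {x : I → ℂ} {n : ℕ} {v : ℝ} (hn : 0 < n)
    (hx : BddAbove (Set.range fun i => ‖x i‖)) (S : Finset I) (hS : n ≤ #S)
    (hv : ∀ i ∈ S, v ≤ ‖x i‖) : v ≤ seqApproxNum x n := by
  refine le_csInf ?_ ?_
  · obtain ⟨B, hB⟩ := hx
    have hempty : {i : I | |B| + 1 ≤ ‖x i‖} = ∅ := by
      ext i
      have h1 : ‖x i‖ ≤ B := hB ⟨i, rfl⟩
      have h2 := le_abs_self B
      simp only [Set.mem_ofPred_eq, Set.mem_empty_iff_false, iff_false]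
      linarith
    refine ⟨|B| + 1, by positivity, ?_, ?_⟩
    · rw [hempty]
      exact Set.finite_empty
    · rw [hempty]
      simpa using hn
  · rintro c ⟨-, hfin, hcard⟩
    by_contra! hc
    have hsub : (S : Set I) ⊆ {i : I | c ≤ ‖x i‖} := fun i hi => hc.le.trans (hv i hi)
    have hle := Set.ncard_le_ncard hsub hfin
    rw [Set.ncard_coe_finset] at hle
    rw [Nat.card_coe_set_eq] at hcard
    omega

theorem seqApproxNum_nonneg {I : Type*} (x : I → ℂ) (n : ℕ) : 0 ≤ seqApproxNum x n :=
  Real.sInf_nonneg fun _ hc => hc.1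

/-- For a sequence with nonincreasing moduli, `a_{n+1}(x) ≤ |x_n|`. -/
theorem seqApproxNum_succ_le_of_antitone {x : ℕ → ℂ} (hx : Antitone fun i => ‖x i‖) (n : ℕ) :
    seqApproxNum x (n + 1) ≤ ‖x n‖ := by
  refine le_of_forall_gt_imp_ge_of_dense fun c hc => ?_
  have hsub : {i : ℕ | c ≤ ‖x i‖} ⊆ (Finset.range n : Set ℕ) := by
    intro i hi
    rw [Finset.mem_coe, Finset.mem_range]
    by_contra! hni
    exact absurd (hi.trans (hx hni)) (not_le.mpr hc)
  refine csInf_le ⟨0, fun _ hc => hc.1⟩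
    ⟨(norm_nonneg _).trans hc.le, (Finset.finite_toSet _).subset hsub, ?_⟩
  have hle := Set.ncard_le_ncard hsub (Finset.finite_toSet _)
  rw [Set.ncard_coe_finset, Finset.card_range] at hle
  rw [Nat.card_coe_set_eq]
  omega

/-- The sequence `(n + 1)^(-1/r) (1 + ⌊log₂ (n + 1)⌋)^(-β)`. -/
def logWeight (r β : ℝ) (n : ℕ) : ℝ :=
  ((n : ℝ) + 1) ^ (-(1 / r)) * ((Nat.log 2 (n + 1) : ℝ) + 1) ^ (-β)

theorem logWeight_pos (r β : ℝ) (n : ℕ) : 0 < logWeight r β n := by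
  unfold logWeight
  positivity

theorem norm_logWeight (r β : ℝ) (n : ℕ) : ‖(logWeight r β n : ℂ)‖ = logWeight r β n :=
  Complex.norm_of_nonneg (logWeight_pos r β n).le

theorem antitone_logWeight {r β : ℝ} (hr : 0 < r) (hβ : 0 < β) : Antitone (logWeight r β) := by
  intro m n hmn
  have hlog : Nat.log 2 (m + 1) ≤ Nat.log 2 (n + 1) := Nat.log_mono_right (by omega)
  refine mul_le_mul ?_ ?_ (by positivity) (by positivity)
  · exact Real.rpow_le_rpow_of_nonpos (by positivity) (by gcongr)
      (neg_nonpos.mpr (by positivity))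
  · exact Real.rpow_le_rpow_of_nonpos (by positivity) (by gcongr) (neg_nonpos.mpr hβ.le)

theorem summable_inv_mul_log_rpow {γ : ℝ} (hγ : 1 < γ) :
    Summable fun n : ℕ => (n : ℝ)⁻¹ * ((Nat.log 2 n : ℝ) + 1) ^ (-γ) := by
  rw [← summable_condensed_iff_of_nonneg (fun n => by positivity)]
  · have h := (summable_nat_add_iff 1).mpr (Real.summable_nat_rpow.mpr (neg_lt_neg hγ))
    refine h.congr fun k => ?_
    rw [Nat.log_pow (by norm_num)]
    push_cast
    rw [← mul_assoc, mul_inv_cancel₀ (by positivity), one_mul]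
  · intro m n hm hmn
    have hlog : Nat.log 2 m ≤ Nat.log 2 n := Nat.log_mono_right hmn
    refine mul_le_mul ?_ ?_ (by positivity) (by positivity)
    · gcongr
    · exact Real.rpow_le_rpow_of_nonpos (by positivity) (by gcongr)
        (by linarith)

theorem memLorentzSeq_logWeight {r u β : ℝ} (hr : 0 < r) (hu : 0 < u) (hβ : 1 < β * u) :
    MemLorentzSeq r u fun n => (logWeight r β n : ℂ) := by
  have hβ0 : 0 < β := pos_of_mul_pos_left (one_pos.trans hβ) hu.le
  have hanti : Antitone fun n => ‖(logWeight r β n : ℂ)‖ := by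
    simpa only [norm_logWeight] using antitone_logWeight hr hβ0
  refine ⟨⟨‖(logWeight r β 0 : ℂ)‖, ?_⟩, ?_⟩
  · rintro _ ⟨n, rfl⟩
    exact hanti n.zero_le
  · refine Summable.of_nonneg_of_le
      (fun n => mul_nonneg (by positivity) (Real.rpow_nonneg (seqApproxNum_nonneg _ _) _))
      (fun n => ?_) ((summable_nat_add_iff 1).mpr (summable_inv_mul_log_rpow hβ))
    have hle := seqApproxNum_succ_le_of_antitone hanti n
    rw [norm_logWeight] at hle
    calc _ ≤ ((n : ℝ) + 1) ^ (u / r - 1) * logWeight r β n ^ u := by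
            gcongr
            exact seqApproxNum_nonneg _ _
      _ = _ := by
            have hn : (0 : ℝ) < (n : ℝ) + 1 := by positivity
            rw [logWeight, Real.mul_rpow (by positivity) (by positivity),
              ← Real.rpow_mul hn.le, ← Real.rpow_mul (by positivity), ← mul_assoc,
              ← Real.rpow_add hn, Nat.cast_add, Nat.cast_one, ← Real.rpow_neg_one]
            congr 2
            · field_simp
              ring
            · ring

/-- The pairs `(a, b)` with `⌊log₂ (a + 1)⌋ + ⌊log₂ (b + 1)⌋ = m`. -/
def dyadicPairs (m : ℕ) : Finset (ℕ × ℕ) :=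
  (Finset.range (m + 1)).biUnion fun j =>
    Finset.Ico (2 ^ j - 1) (2 ^ (j + 1) - 1) ×ˢ
      Finset.Ico (2 ^ (m - j) - 1) (2 ^ (m - j + 1) - 1)

theorem log_two_succ_of_mem_Ico {n j : ℕ} (hn : n ∈ Finset.Ico (2 ^ j - 1) (2 ^ (j + 1) - 1)) :
    Nat.log 2 (n + 1) = j := by
  rw [Finset.mem_Ico] at hn
  exact Nat.log_eq_of_pow_le_of_lt_pow (by omega) (by omega)

theorem log_add_log_of_mem_dyadicPairs {m : ℕ} {p : ℕ × ℕ} (hp : p ∈ dyadicPairs m) :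
    Nat.log 2 (p.1 + 1) + Nat.log 2 (p.2 + 1) = m := by
  simp only [dyadicPairs, Finset.mem_biUnion, Finset.mem_product, Finset.mem_range] at hp
  obtain ⟨j, hj, h1, h2⟩ := hp
  rw [log_two_succ_of_mem_Ico h1, log_two_succ_of_mem_Ico h2]
  omega

theorem card_dyadicPairs (m : ℕ) : (dyadicPairs m).card = (m + 1) * 2 ^ m := by
  have hcard (j : ℕ) : (Finset.Ico (2 ^ j - 1) (2 ^ (j + 1) - 1)).card = 2 ^ j := by
    rw [Nat.card_Ico, pow_succ]
    have := Nat.one_le_two_pow (n := j)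
    omega
  rw [dyadicPairs, Finset.card_biUnion]
  · rw [Finset.sum_congr rfl (g := fun _ => 2 ^ m), Finset.sum_const, Finset.card_range,
      smul_eq_mul]
    intro j hj
    rw [Finset.card_product, hcard, hcard, ← pow_add]
    congr 1
    have := Finset.mem_range.mp hj
    omega
  · intro i _ j _ hij
    refine Finset.disjoint_left.mpr fun p hi hj => hij ?_
    rw [← log_two_succ_of_mem_Ico (Finset.mem_product.mp hi).1,
      ← log_two_succ_of_mem_Ico (Finset.mem_product.mp hj).1]

theorem le_logWeight_mul_logWeight {r β : ℝ} (hr : 0 < r) (hβ : 0 < β) {m : ℕ} {p : ℕ × ℕ}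
    (hp : Nat.log 2 (p.1 + 1) + Nat.log 2 (p.2 + 1) = m) :
    ((2 : ℝ) ^ (m + 2)) ^ (-(1 / r)) * ((m : ℝ) + 1) ^ (-(2 * β)) ≤
      logWeight r β p.1 * logWeight r β p.2 := by
  have hlt (n : ℕ) : (n : ℝ) + 1 ≤ 2 ^ (Nat.log 2 (n + 1) + 1) := by
    exact_mod_cast (Nat.lt_pow_succ_log_self (by norm_num) (n + 1)).le
  have hprod : ((p.1 : ℝ) + 1) * ((p.2 : ℝ) + 1) ≤ 2 ^ (m + 2) := by
    calc _ ≤ (2 : ℝ) ^ (Nat.log 2 (p.1 + 1) + 1) * 2 ^ (Nat.log 2 (p.2 + 1) + 1) := by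
            gcongr <;> exact hlt _
      _ = _ := by
            rw [← pow_add]
            congr 1
            omega
  have hm1 : (Nat.log 2 (p.1 + 1) : ℝ) ≤ m := by exact_mod_cast (by omega)
  have hm2 : (Nat.log 2 (p.2 + 1) : ℝ) ≤ m := by exact_mod_cast (by omega)
  have hlog : ((Nat.log 2 (p.1 + 1) : ℝ) + 1) * ((Nat.log 2 (p.2 + 1) : ℝ) + 1) ≤
      ((m : ℝ) + 1) ^ (2 : ℝ) := by
    rw [Real.rpow_two, sq]
    gcongr
  unfold logWeight
  rw [mul_mul_mul_comm, ← Real.mul_rpow (by positivity) (by positivity),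
    ← Real.mul_rpow (by positivity) (by positivity), ← mul_neg 2 β,
    Real.rpow_mul (by positivity)]
  refine mul_le_mul ?_ ?_ (by positivity) (by positivity)
  · exact Real.rpow_le_rpow_of_nonpos (by positivity) hprod (neg_nonpos.mpr (by positivity))
  · exact Real.rpow_le_rpow_of_nonpos (by positivity) hlog (neg_nonpos.mpr hβ.le)

/-- Sums of a nonnegative summable sequence over consecutive blocks are summable. -/
theorem Summable.sum_Ico_of_monotone {b : ℕ → ℝ} (hb : Summable b) (hb0 : ∀ n, 0 ≤ b n)
    {P : ℕ → ℕ} (hP : Monotone P) :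
    Summable fun m => ∑ n ∈ Finset.Ico (P m) (P (m + 1)), b n := by
  refine summable_of_sum_range_le (c := ∑' n, b n)
    (fun m => Finset.sum_nonneg fun n _ => hb0 n) fun M => ?_
  refine le_trans ?_ (hb.sum_le_tsum (Finset.range (P M)) fun n _ => hb0 n)
  induction M with
  | zero => simpa using Finset.sum_nonneg fun n _ => hb0 n
  | succ M ih =>
    rw [Finset.sum_range_succ, ← Finset.sum_range_add_sum_Ico b (hP M.le_succ)]
    gcongr

theorem not_memLorentzSeq_logWeight_tensor {r u β : ℝ} (hr : 0 < r) (hru : r < u)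
    (hβ : 0 < β) (hβu : 2 * β * u ≤ 1 + u / r) :
    ¬ MemLorentzSeq r u fun p : ℕ × ℕ => (logWeight r β p.1 : ℂ) * (logWeight r β p.2 : ℂ) := by
  rintro ⟨hbdd, hsum⟩
  have hu : 0 < u := hr.trans hru
  have hs : 1 < u / r := (one_lt_div hr).mpr hru
  set s := u / r with hsdef
  have hP : Monotone fun m : ℕ => (m + 1) * 2 ^ m := by
    intro m n hmn
    dsimp only
    gcongr
    norm_num
  have hblocks := hsum.sum_Ico_of_monotone
    (fun n => mul_nonneg (by positivity) (Real.rpow_nonneg (seqApproxNum_nonneg _ _) _)) hP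
  have hdiv : ¬ Summable fun m : ℕ => ((16 : ℝ) ^ s)⁻¹ * (((m + 2 : ℕ) : ℝ))⁻¹ := by
    rw [summable_mul_left_iff (by positivity),
      summable_nat_add_iff (f := fun n : ℕ => (n : ℝ)⁻¹) 2]
    exact Real.not_summable_natCast_inv
  refine hdiv (Summable.of_nonneg_of_le (fun m => by positivity) (fun m => ?_) hblocks)
  set P : ℝ := ((m : ℝ) + 1) * 2 ^ m with hPdef
  have hP0 : 0 < P := by positivity
  set V : ℝ := ((2 : ℝ) ^ (m + 1 + 2)) ^ (-(1 / r)) * (((m + 1 : ℕ) : ℝ) + 1) ^ (-(2 * β))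
    with hV
  have hV0 : 0 < V := by positivity
  have hterm : ∀ n ∈ Finset.Ico ((m + 1) * 2 ^ m) ((m + 1 + 1) * 2 ^ (m + 1)),
      P ^ (s - 1) * V ^ u ≤ ((n : ℝ) + 1) ^ (s - 1) * seqApproxNum
        (fun p : ℕ × ℕ => (logWeight r β p.1 : ℂ) * (logWeight r β p.2 : ℂ)) (n + 1) ^ u := by
    intro n hn
    rw [Finset.mem_Ico] at hn
    have hPn : P ≤ (n : ℝ) + 1 := by
      have : (((m + 1) * 2 ^ m : ℕ) : ℝ) ≤ n := by exact_mod_cast hn.1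
      push_cast at this
      linarith
    have hVa := le_seqApproxNum (v := V) n.succ_pos hbdd (dyadicPairs (m + 1))
      (by rw [card_dyadicPairs]; omega) fun p hp => by
        rw [norm_mul, norm_logWeight, norm_logWeight]
        exact le_logWeight_mul_logWeight hr hβ (log_add_log_of_mem_dyadicPairs hp)
    have hs' : 0 ≤ s - 1 := by linarith
    gcongr
  have hcard : P ≤ ((Finset.Ico ((m + 1) * 2 ^ m) ((m + 1 + 1) * 2 ^ (m + 1))).card : ℝ) := by
    have h : (m + 1) * 2 ^ m + (m + 1) * 2 ^ m ≤ (m + 1 + 1) * 2 ^ (m + 1) := by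
      rw [pow_succ]
      nlinarith [Nat.one_le_two_pow (n := m)]
    rw [Nat.card_Ico, hPdef]
    exact_mod_cast Nat.le_sub_of_add_le h
  calc ((16 : ℝ) ^ s)⁻¹ * ((m + 2 : ℕ) : ℝ)⁻¹ ≤ P ^ s * V ^ u := ?_
    _ = P * (P ^ (s - 1) * V ^ u) := by
        rw [← mul_assoc, Real.rpow_sub_one hP0.ne', mul_div_cancel₀ _ hP0.ne']
    _ ≤ (Finset.Ico ((m + 1) * 2 ^ m) ((m + 1 + 1) * 2 ^ (m + 1))).card *
          (P ^ (s - 1) * V ^ u) := by gcongr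
    _ ≤ _ := by
        rw [← nsmul_eq_mul]
        exact Finset.card_nsmul_le_sum _ _ _ hterm
  have hm2 : (((m + 1 : ℕ) : ℝ) + 1) = (m : ℝ) + 2 := by push_cast; ring
  have hVu : V ^ u = ((2 : ℝ) ^ (m + 1 + 2)) ^ (-s) * ((m : ℝ) + 2) ^ (-(2 * β * u)) := by
    rw [hV, hm2, Real.mul_rpow (by positivity) (by positivity), ← Real.rpow_mul (by positivity),
      ← Real.rpow_mul (by positivity), hsdef]
    congr 2 <;> ring
  have hhalf : (((m : ℝ) + 2) / 2 * 2 ^ m) ^ s ≤ P ^ s := by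
    refine Real.rpow_le_rpow (by positivity) ?_ (by linarith)
    rw [hPdef]
    gcongr
    linarith [(m.cast_nonneg : (0 : ℝ) ≤ m)]
  have hexp : ((m : ℝ) + 2) ^ (-(1 + s)) ≤ ((m : ℝ) + 2) ^ (-(2 * β * u)) :=
    Real.rpow_le_rpow_of_exponent_le (by linarith [(m.cast_nonneg : (0 : ℝ) ≤ m)]) (by linarith)
  rw [hVu]
  calc ((16 : ℝ) ^ s)⁻¹ * ((m + 2 : ℕ) : ℝ)⁻¹
      = (((m : ℝ) + 2) / 2 * 2 ^ m) ^ s *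
        (((2 : ℝ) ^ (m + 1 + 2)) ^ (-s) * ((m : ℝ) + 2) ^ (-(1 + s))) := by
        have h : (((m : ℝ) + 2) / 2 * 2 ^ m) ^ s =
            ((2 : ℝ) ^ (m + 1 + 2)) ^ s * ((m : ℝ) + 2) ^ s * ((16 : ℝ) ^ s)⁻¹ := by
          rw [← Real.mul_rpow (by positivity) (by positivity),
            ← Real.inv_rpow (by norm_num), ← Real.mul_rpow (by positivity) (by norm_num)]
          congr 1
          ring
        rw [h, Real.rpow_neg (by positivity), Real.rpow_neg (by positivity),
          Real.rpow_add (by positivity), Real.rpow_one]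
        push_cast
        field_simp
    _ ≤ P ^ s * (((2 : ℝ) ^ (m + 1 + 2)) ^ (-s) * ((m : ℝ) + 2) ^ (-(2 * β * u))) := by
        refine mul_le_mul hhalf ?_ (by positivity) (by positivity)
        exact mul_le_mul_of_nonneg_left hexp (by positivity)

/-- **Statement 19.** Let `r, u ∈ (0,∞)`. If for all `x, y ∈ ℓ_{r,u}(ℕ)` the double
family `x ⊗ y = (x_n y_m)` belongs to `ℓ_{r,u}(ℕ×ℕ)`, then `u ≤ r`. -/
theorem lorentz_tensor_stable_implies_le
    (r u : ℝ) (hr : 0 < r) (hu : 0 < u)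
    (h : ∀ x y : ℕ → ℂ, MemLorentzSeq r u x → MemLorentzSeq r u y →
      MemLorentzSeq r u (fun nm : ℕ × ℕ => x nm.1 * y nm.2)) :
    u ≤ r := by
  by_contra! hru
  have hs : 1 < u / r := (one_lt_div hr).mpr hru
  have hβu : (1 + u / r) / (2 * u) * u = (1 + u / r) / 2 := by field_simp
  have hx : MemLorentzSeq r u fun n => (logWeight r ((1 + u / r) / (2 * u)) n : ℂ) :=
    memLorentzSeq_logWeight hr hu (by linarith)
  have hxx := h _ _ hx hx
  have hβu' : 2 * ((1 + u / r) / (2 * u)) * u ≤ 1 + u / r := by linarith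
  exact not_memLorentzSeq_logWeight_tensor hr hru (by positivity) hβu' hxx

end
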